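/- Let B be standard Brownian motion and g_t = sup{s ≤ t : B_s = 0}. Then the process A_t = sign(B_t) · √(π/2) · √(t − g_t) is a martingale with respect to the filtration generated by (sign(B_s))_{s ≤ t} (suitably completed and made right-continuous). -/

import Mathlib

open Set MeasureTheory ProbabilityTheory
open scoped NNReal

namespace Azema
set_option linter.unusedSectionVars false
open Filter Topology

variable {Ω : Type*} [m : MeasurableSpace Ω]

/-- Brownian motion with arbitrary starting value. -/
structure BMLike (P : Measure Ω) (X : ℝ≥0 → Ω → ℝ) : Prop where
  meas : ∀ t, Measurable (X t)
  cont : ∀ ω, Continuous fun t => X t ω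
  gauss : ∀ s t : ℝ≥0, s ≤ t → P.map (fun ω => X t ω - X s ω) = gaussianReal 0 (t - s)
  indep : ∀ s t : ℝ≥0, s ≤ t →
      IndepFun (fun ω => X t ω - X s ω)
        (fun ω => fun u : {u : ℝ≥0 // u ≤ s} => X u ω) P

/-- past sigma-algebra -/
@[reducible]
def Fil (X : ℝ≥0 → Ω → ℝ) (s : ℝ≥0) : MeasurableSpace Ω :=
  MeasurableSpace.comap (fun ω => fun u : {u : ℝ≥0 // u ≤ s} => X u ω) MeasurableSpace.pi

/-- there is a zero in `[a, b]` -/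
def Zs (X : ℝ≥0 → Ω → ℝ) (a b : ℝ≥0) : Set Ω := {ω | ∃ s, a ≤ s ∧ s ≤ b ∧ X s ω = 0}

lemma measurable_fil (X : ℝ≥0 → Ω → ℝ) {s t : ℝ≥0} (h : s ≤ t) : Measurable[Fil X t] (X s) := by
  have h1 : Measurable[Fil X t] (fun ω => fun u : {u : ℝ≥0 // u ≤ t} => X u ω) :=
    comap_measurable _
  exact (measurable_pi_apply (⟨s, h⟩ : {u : ℝ≥0 // u ≤ t})).comp h1

lemma fil_le (X : ℝ≥0 → Ω → ℝ) (hX : ∀ t, Measurable (X t)) (s : ℝ≥0) : Fil X s ≤ m := by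
  refine Measurable.comap_le ?_
  exact measurable_pi_lambda _ fun u => hX _

lemma fil_mono (X : ℝ≥0 → Ω → ℝ) {s t : ℝ≥0} (h : s ≤ t) : Fil X s ≤ Fil X t := by
  refine Measurable.comap_le ?_
  exact @measurable_pi_lambda _ _ _ (Fil X t) _ _ fun u => measurable_fil X (u.2.trans h)

lemma zs_meas (X : ℝ≥0 → Ω → ℝ) (hc : ∀ ω, Continuous fun t => X t ω) (a b : ℝ≥0) :
    MeasurableSet[Fil X b] (Zs X a b) := by
  by_cases hab : a ≤ b
  swap
  · have : Zs X a b = ∅ := by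
      ext ω
      simp only [Zs, mem_ofPred_eq, mem_empty_iff_false, iff_false]
      rintro ⟨s, h1, h2, -⟩
      exact hab (h1.trans h2)
    rw [this]; exact @MeasurableSet.empty _ (Fil X b)
  have : Nonempty (Icc a b) := ⟨⟨a, le_refl _, hab⟩⟩
  have : Zs X a b = ⋂ k : ℕ, ⋃ i : ℕ,
      {ω | |X (TopologicalSpace.denseSeq (Icc a b) i : ℝ≥0) ω| < 1 / ((k : ℝ) + 1)} := by
    ext ω
    have hcz : Continuous fun t : Icc a b => |X t ω| := ((hc ω).comp continuous_subtype_val).abs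
    simp only [Zs, mem_ofPred_eq, mem_iInter, mem_iUnion]
    constructor
    · rintro ⟨s, h1, h2, h3⟩ k
      have hopen : IsOpen {t : Icc a b | |X t ω| < 1 / ((k : ℝ) + 1)} :=
        isOpen_lt hcz continuous_const
      obtain ⟨i, hi⟩ := (TopologicalSpace.denseRange_denseSeq (Icc a b)).exists_mem_open hopen
        ⟨⟨s, h1, h2⟩, by simp only [mem_ofPred_eq, h3, abs_zero]; positivity⟩
      exact ⟨i, hi⟩
    · intro h
      obtain ⟨t, -, ht⟩ := (isCompact_univ (X := Icc a b)).exists_isMinOn univ_nonempty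
        hcz.continuousOn
      refine ⟨t, t.2.1, t.2.2, ?_⟩
      by_contra hne
      have hpos : 0 < |X t ω| := abs_pos.2 hne
      obtain ⟨k, hk⟩ := exists_nat_one_div_lt hpos
      obtain ⟨i, hi⟩ := h k
      have := ht (mem_univ (TopologicalSpace.denseSeq (Icc a b) i))
      simp only [mem_ofPred_eq] at this
      linarith
  rw [this]
  refine MeasurableSet.iInter fun k => MeasurableSet.iUnion fun i => ?_
  have h1 : Measurable[Fil X b] (fun ω => |X (TopologicalSpace.denseSeq (Icc a b) i : ℝ≥0) ω|) :=
    continuous_abs.measurable.comp (measurable_fil X (TopologicalSpace.denseSeq (Icc a b) i).2.2)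
  exact h1 measurableSet_Iio

lemma tendsto_grid {T : ℝ≥0} {a : ℕ → ℝ≥0} (h1 : ∀ n, T ≤ a n)
    (h2 : ∀ n, a n ≤ T + 1 / ((n : ℝ≥0) + 1)) : Tendsto a atTop (𝓝 T) := by
  refine tendsto_of_tendsto_of_tendsto_of_le_of_le tendsto_const_nhds ?_ h1 h2
  have := (tendsto_one_div_add_atTop_nhds_zero_nat (𝕜 := ℝ≥0)).const_add T
  simpa using this

variable {P : Measure Ω} [IsProbabilityMeasure P] {X : ℝ≥0 → Ω → ℝ}

lemma markov (hX : BMLike P X) {s u : ℝ≥0} (hsu : s ≤ u) (K : Ω → ℝ) (hK : Measurable[Fil X s] K)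
    (hKb : ∀ ω, |K ω| ≤ 1) (h : ℝ × ℝ → ℝ) (hh : Measurable h)
    (hIntg : Integrable (fun ω => h (X s ω, X u ω - X s ω)) P) :
    ∫ ω, K ω * h (X s ω, X u ω - X s ω) ∂P
      = ∫ ω, K ω * ∫ y, h (X s ω, y) ∂(gaussianReal 0 (u - s)) ∂P := by
  have hle := fil_le X hX.meas s
  have hKm : Measurable K := hK.mono hle le_rfl
  have hY : Measurable (fun ω => X u ω - X s ω) := (hX.meas u).sub (hX.meas s)
  have hpair : Measurable[Fil X s] (fun ω => (X s ω, K ω)) :=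
    (measurable_fil X le_rfl).prodMk hK
  have hpairm : Measurable (fun ω => (X s ω, K ω)) := hpair.mono hle le_rfl
  have hind : IndepFun (fun ω => X u ω - X s ω) (fun ω => (X s ω, K ω)) P := by
    have h1 := hX.indep s u hsu
    rw [IndepFun_iff_Indep] at h1 ⊢
    exact indep_of_indep_of_le_right h1 hpair.comap_le
  have hmap := (indepFun_iff_map_prod_eq_prod_map_map hY.aemeasurable hpairm.aemeasurable).1 hind
  rw [hX.gauss s u hsu] at hmap
  set q : ℝ × ℝ × ℝ → ℝ := fun z => z.2.2 * h (z.2.1, z.1) with hq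
  have hqm : Measurable q := by fun_prop
  have hT : Measurable (fun ω => (X u ω - X s ω, (X s ω, K ω))) := hY.prodMk hpairm
  have hIntg2 : Integrable (fun ω => K ω * h (X s ω, X u ω - X s ω)) P :=
    hIntg.bdd_mul hKm.aestronglyMeasurable (Eventually.of_forall hKb)
  have hIntg3 : Integrable q (Measure.map (fun ω => (X u ω - X s ω, (X s ω, K ω))) P) :=
    (integrable_map_measure hqm.aestronglyMeasurable hT.aemeasurable).2 hIntg2
  have := Measure.isProbabilityMeasure_map (μ := P) hpairm.aemeasurable
  calc ∫ ω, K ω * h (X s ω, X u ω - X s ω) ∂P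
      = ∫ z, q z ∂(Measure.map (fun ω => (X u ω - X s ω, (X s ω, K ω))) P) :=
        (integral_map hT.aemeasurable hqm.aestronglyMeasurable).symm
    _ = ∫ z, ∫ y, q (y, z) ∂(gaussianReal 0 (u - s)) ∂(Measure.map (fun ω => (X s ω, K ω)) P) := by
        rw [hmap] at hIntg3 ⊢
        exact integral_prod_symm _ hIntg3
    _ = ∫ ω, ∫ y, q (y, (X s ω, K ω)) ∂(gaussianReal 0 (u - s)) ∂P := by
        rw [integral_map hpairm.aemeasurable]
        exact (hqm.stronglyMeasurable.integral_prod_left).aestronglyMeasurable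
    _ = _ := by
        simp only [hq, integral_const_mul]

lemma reflect (hX : BMLike P X) {s u : ℝ≥0} (hsu : s ≤ u) (K : Ω → ℝ) (hK : Measurable[Fil X s] K)
    (hKb : ∀ ω, |K ω| ≤ 1) (f : ℝ → ℝ) (hf : Continuous f) (C : ℝ) (hC : ∀ x, |f x| ≤ C) :
    ∫ ω, K ω * f (X u ω) ∂P = ∫ ω, K ω * f (2 * X s ω - X u ω) ∂P := by
  have hb : ∀ g : Ω → ℝ, Measurable g → Integrable (fun ω => f (g ω)) P := fun g hg =>
    Integrable.of_bound (hf.measurable.comp hg).aestronglyMeasurable C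
      (Eventually.of_forall fun ω => hC _)
  have m1 := hX.meas s
  have m2 := hX.meas u
  have hfm := hf.measurable
  have e1 := markov hX hsu K hK hKb (fun z => f (z.1 + z.2)) (by fun_prop)
    (hb _ (by fun_prop))
  have e2 := markov hX hsu K hK hKb (fun z => f (z.1 - z.2)) (by fun_prop)
    (hb _ (by fun_prop))
  have hsym : ∀ x : ℝ, ∫ y, f (x + y) ∂(gaussianReal 0 (u - s))
      = ∫ y, f (x - y) ∂(gaussianReal 0 (u - s)) := by
    intro x
    have : gaussianReal 0 (u - s) = (gaussianReal 0 (u - s)).map (fun y => - y) := by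
      rw [gaussianReal_map_neg, neg_zero]
    conv_lhs => rw [this]
    rw [integral_map (by fun_prop) (by fun_prop)]
    simp [sub_eq_add_neg]
  simp only [hsym] at e1
  rw [← e2] at e1
  convert e1 using 4
  · ring_nf
  · ring_nf

lemma first_zero (hX : BMLike P X) {d u : ℝ≥0} (hdu : d ≤ u) (K : Ω → ℝ)
    (hK : Measurable[Fil X d] K)
    (hKb : ∀ ω, |K ω| ≤ 1) (f : ℝ → ℝ) (hf : Continuous f) (C : ℝ) (hC : ∀ x, |f x| ≤ C)
    (hodd : ∀ x, f (-x) = - f x) :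
    ∫ ω in Zs X d u, K ω * f (X u ω) ∂P = 0 := by
  classical
  have hC0 : 0 ≤ C := (abs_nonneg _).trans (hC 0)
  set T : Ω → ℝ≥0 := fun ω => sInf {s | d ≤ s ∧ X s ω = 0} with hT
  have hTmem : ∀ ω ∈ Zs X d u, d ≤ T ω ∧ X (T ω) ω = 0 := by
    rintro ω ⟨s, h1, h2, h3⟩
    have hcl : IsClosed {s | d ≤ s ∧ X s ω = 0} :=
      (isClosed_le continuous_const continuous_id).inter
        (isClosed_eq (hX.cont ω) continuous_const)
    exact hcl.csInf_mem ⟨s, h1, h3⟩ (OrderBot.bddBelow _)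
  have hTle : ∀ ω s, d ≤ s → X s ω = 0 → T ω ≤ s := fun ω s h1 h2 =>
    csInf_le (OrderBot.bddBelow _) ⟨h1, h2⟩
  have hTu : ∀ ω ∈ Zs X d u, T ω ≤ u := by
    rintro ω ⟨s, h1, h2, h3⟩
    exact (hTle ω s h1 h3).trans h2
  set κ : ℕ → Ω → ℕ := fun n ω => ⌈((n : ℝ≥0) + 1) * T ω⌉₊ with hκ
  set dd : ℕ → ℕ → ℝ≥0 := fun n k => min u ((k : ℝ≥0) / ((n : ℝ≥0) + 1)) with hdd
  set E : ℕ → ℕ → Set Ω := fun n k => Zs X d (dd n k) \ ⋃ j ∈ Finset.range k, Zs X d (dd n j)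
    with hE
  have hsub : ∀ n j ω, ω ∈ Zs X d (dd n j) ↔ ω ∈ Zs X d u ∧ κ n ω ≤ j := by
    intro n j ω
    have hkj : κ n ω ≤ j ↔ T ω ≤ (j : ℝ≥0) / ((n : ℝ≥0) + 1) := by
      simp only [hκ]
      rw [Nat.ceil_le, le_div_iff₀ (by positivity), mul_comm]
    rw [hkj]
    constructor
    · rintro ⟨s, h1, h2, h3⟩
      exact ⟨⟨s, h1, h2.trans (min_le_left _ _), h3⟩,
        (hTle ω s h1 h3).trans (h2.trans (min_le_right _ _))⟩
    · rintro ⟨hz, h⟩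
      exact ⟨T ω, (hTmem ω hz).1, le_min (hTu ω hz) h, (hTmem ω hz).2⟩
  have hEiff : ∀ n k ω, ω ∈ E n k ↔ ω ∈ Zs X d u ∧ κ n ω = k := by
    intro n k ω
    simp only [hE, Set.mem_sdiff, mem_iUnion, Finset.mem_range, hsub]
    constructor
    · rintro ⟨⟨hz, h1⟩, h2⟩
      refine ⟨hz, le_antisymm h1 ?_⟩
      by_contra hlt
      exact h2 ⟨κ n ω, by omega, hz, le_rfl⟩
    · rintro ⟨hz, rfl⟩
      refine ⟨⟨hz, le_rfl⟩, ?_⟩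
      rintro ⟨j, hj, -, h3⟩
      omega
  have hEm : ∀ n k, MeasurableSet[Fil X (dd n k)] (E n k) := by
    intro n k
    refine MeasurableSet.diff (zs_meas X hX.cont _ _) ?_
    refine MeasurableSet.biUnion (Finset.countable_toSet _) fun j hj => ?_
    have hjk : dd n j ≤ dd n k := by
      simp only [hdd]
      have : (j : ℝ≥0) ≤ k := by
        exact_mod_cast (Finset.mem_range.1 hj).le
      gcongr
    exact fil_mono X hjk _ (zs_meas X hX.cont _ _)
  have hEm' : ∀ n k, MeasurableSet (E n k) := fun n k => fil_le X hX.meas _ _ (hEm n k)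
  have hZm : MeasurableSet (Zs X d u) := fil_le X hX.meas _ _ (zs_meas X hX.cont _ _)
  have hKm : Measurable K := hK.mono (fil_le X hX.meas d) le_rfl
  have hpiece : ∀ n k, ∫ ω, (E n k).indicator K ω * f (X u ω) ∂P
      = ∫ ω, (E n k).indicator K ω * f (2 * X (dd n k) ω - X u ω) ∂P := by
    intro n k
    by_cases hd : d ≤ dd n k
    · refine reflect hX (min_le_left _ _) _ ?_ ?_ f hf C hC
      · exact (hK.mono (fil_mono X hd) le_rfl).indicator (hEm n k)
      · intro ω
        by_cases hω : ω ∈ E n k <;> simp [hω, hKb]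
    · have : E n k = ∅ := by
        ext ω
        simp only [hE, Set.mem_sdiff, mem_empty_iff_false, iff_false, not_and]
        rintro ⟨s, h1, h2, -⟩
        exact absurd (h1.trans h2) hd
      simp [this]
  set N : ℕ → ℕ := fun n => ⌈((n : ℝ≥0) + 1) * u⌉₊ + 1 with hN
  have hκN : ∀ n, ∀ ω ∈ Zs X d u, κ n ω ∈ Finset.range (N n) := by
    intro n ω hω
    simp only [hκ, hN, Finset.mem_range]
    refine Nat.lt_succ_of_le (Nat.ceil_mono ?_)
    have := hTu ω hω
    gcongr
  have hsum : ∀ (n : ℕ) (F : ℕ → Ω → ℝ) (ω : Ω),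
      ∑ k ∈ Finset.range (N n), (E n k).indicator K ω * F k ω
        = (Zs X d u).indicator (fun ω => K ω * F (κ n ω) ω) ω := by
    intro n F ω
    by_cases hω : ω ∈ Zs X d u
    · rw [Finset.sum_eq_single_of_mem (κ n ω) (hκN n ω hω)]
      · have : ω ∈ E n (κ n ω) := (hEiff _ _ _).2 ⟨hω, rfl⟩
        simp [this, hω]
      · intro k _ hk
        have : ω ∉ E n k := fun h => hk ((hEiff _ _ _).1 h).2.symm
        simp [this]
    · rw [Finset.sum_eq_zero]
      · simp [hω]
      · intro k _
        have : ω ∉ E n k := fun h => hω ((hEiff _ _ _).1 h).1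
        simp [this]
  have hfm := hf.measurable
  have m2 := hX.meas
  have hind : ∀ n k, Measurable ((E n k).indicator K) := fun n k => hKm.indicator (hEm' n k)
  have hIntg : ∀ n k (g : Ω → ℝ), Measurable g →
      Integrable (fun ω => (E n k).indicator K ω * f (g ω)) P := by
    intro n k g hg
    refine Integrable.of_bound ((hind n k).mul (hfm.comp hg)).aestronglyMeasurable C
      (Eventually.of_forall fun ω => ?_)
    rw [norm_mul]
    have h1 : ‖(E n k).indicator K ω‖ ≤ 1 := by
      by_cases hω : ω ∈ E n k <;> simp [hω, hKb]
    have h2 : ‖f (g ω)‖ ≤ C := hC _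
    calc _ ≤ 1 * C := by gcongr
      _ = C := one_mul C
  have hG : ∀ n : ℕ, ∫ ω in Zs X d u, K ω * f (X u ω) ∂P
      = ∫ ω, ∑ k ∈ Finset.range (N n),
          (E n k).indicator K ω * f (2 * X (dd n k) ω - X u ω) ∂P := by
    intro n
    rw [integral_finsetSum _ fun k _ => hIntg n k _ (by have := m2 (dd n k); have := m2 u; fun_prop)]
    simp only [← hpiece]
    rw [← integral_finsetSum _ fun k _ => hIntg n k _ (m2 u), ← integral_indicator hZm]
    congr 1
    ext ω
    rw [hsum n (fun _ ω => f (X u ω))]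
  have hlim : Tendsto (fun n : ℕ => ∫ ω, ∑ k ∈ Finset.range (N n),
          (E n k).indicator K ω * f (2 * X (dd n k) ω - X u ω) ∂P) atTop
      (𝓝 (∫ ω, (Zs X d u).indicator (fun ω => K ω * f (- X u ω)) ω ∂P)) := by
    refine tendsto_integral_of_dominated_convergence (fun _ => C) ?_ (integrable_const C) ?_ ?_
    · intro n
      refine (Finset.measurable_fun_sum _ fun k _ => ?_).aestronglyMeasurable
      have := m2 (dd n k)
      have := m2 u
      have := hind n k
      fun_prop
    · intro n
      refine Eventually.of_forall fun ω => ?_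
      rw [hsum n (fun k ω => f (2 * X (dd n k) ω - X u ω))]
      by_cases hω : ω ∈ Zs X d u
      · simp only [hω, indicator_of_mem, norm_mul]
        calc _ ≤ 1 * C := by
              gcongr
              · exact hKb ω
              · exact hC _
          _ = C := one_mul C
      · simp [hω, hC0]
    · refine Eventually.of_forall fun ω => ?_
      simp only [fun n => hsum n (fun k ω => f (2 * X (dd n k) ω - X u ω)) ω]
      by_cases hω : ω ∈ Zs X d u
      · simp only [hω, indicator_of_mem]
        refine Tendsto.const_mul _ ?_
        have h1 : Tendsto (fun n : ℕ => dd n (κ n ω)) atTop (𝓝 (T ω)) := by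
          have h2 : Tendsto (fun n : ℕ => (κ n ω : ℝ≥0) / ((n : ℝ≥0) + 1)) atTop (𝓝 (T ω)) := by
            refine tendsto_grid (fun n => ?_) (fun n => ?_)
            · rw [le_div_iff₀ (by positivity), mul_comm]
              exact Nat.le_ceil _
            · rw [div_le_iff₀ (by positivity), add_mul, one_div,
                inv_mul_cancel₀ (by positivity), mul_comm]
              exact (Nat.ceil_lt_add_one (by positivity)).le
          have := (tendsto_const_nhds (x := u)).min h2
          rwa [min_eq_right (hTu ω hω)] at this
        have h2 := ((hX.cont ω).tendsto (T ω)).comp h1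
        rw [(hTmem ω hω).2] at h2
        have h3 : Tendsto (fun n : ℕ => 2 * X (dd n (κ n ω)) ω - X u ω) atTop (𝓝 (- X u ω)) := by
          have := (h2.const_mul 2).sub_const (X u ω)
          simpa using this
        exact (hf.tendsto _).comp h3
      · simp [hω]
  have heq := tendsto_nhds_unique (hlim.congr fun n => (hG n).symm) tendsto_const_nhds
  rw [integral_indicator hZm] at heq
  simp only [hodd, mul_neg, integral_neg] at heq
  linarith

end Azema

namespace Azema
open Filter Topology
set_option linter.unusedSectionVars false

variable {Ω : Type*} [m : MeasurableSpace Ω]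
variable {P : Measure Ω} [IsProbabilityMeasure P] {X : ℝ≥0 → Ω → ℝ}

lemma measurable_sign : Measurable Real.sign := by
  have : Real.sign = fun r : ℝ => if r < 0 then (-1 : ℝ) else if 0 < r then 1 else 0 := by
    ext r; rfl
  rw [this]
  exact Measurable.ite measurableSet_Iio measurable_const
    (Measurable.ite measurableSet_Ioi measurable_const measurable_const)

lemma abs_sign_le (x : ℝ) : |Real.sign x| ≤ 1 := by
  rcases Real.sign_apply_eq x with h | h | h <;> simp [h]

lemma first_zero_lim (hX : BMLike P X) {d u : ℝ≥0} (hdu : d ≤ u) (K : Ω → ℝ)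
    (hK : Measurable[Fil X d] K) (hKb : ∀ ω, |K ω| ≤ 1)
    (f : ℕ → ℝ → ℝ) (hf : ∀ n, Continuous (f n)) (C : ℕ → ℝ) (hC : ∀ n x, |f n x| ≤ C n)
    (hodd : ∀ n x, f n (-x) = - f n x) (h g : ℝ → ℝ)
    (hfg : ∀ n x, |f n x| ≤ g x) (hg : Integrable (fun ω => g (X u ω)) P)
    (hlim : ∀ x, Tendsto (fun n => f n x) atTop (𝓝 (h x))) :
    ∫ ω in Zs X d u, K ω * h (X u ω) ∂P = 0 := by
  have hKm : Measurable K := hK.mono (fil_le X hX.meas d) le_rfl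
  have : Tendsto (fun n => ∫ ω in Zs X d u, K ω * f n (X u ω) ∂P) atTop
      (𝓝 (∫ ω in Zs X d u, K ω * h (X u ω) ∂P)) := by
    refine tendsto_integral_of_dominated_convergence (fun ω => g (X u ω)) ?_ hg.integrableOn ?_ ?_
    · intro n
      have h1 := hX.meas u
      have h2 := (hf n).measurable
      exact (hKm.mul (h2.comp h1)).aestronglyMeasurable
    · intro n
      refine Eventually.of_forall fun ω => ?_
      rw [norm_mul]
      calc _ ≤ 1 * g (X u ω) := by
            gcongr
            · exact hKb ω
            · exact hfg _ _
        _ = _ := one_mul _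
    · exact Eventually.of_forall fun ω => (hlim _).const_mul _
  refine tendsto_nhds_unique this ?_
  simp only [fun n => first_zero hX hdu K hK hKb (f n) (hf n) (C n) (hC n) (hodd n)]
  exact tendsto_const_nhds

lemma first_zero_id (hX : BMLike P X) {d u : ℝ≥0} (hdu : d ≤ u) (K : Ω → ℝ)
    (hK : Measurable[Fil X d] K) (hKb : ∀ ω, |K ω| ≤ 1) (hi : Integrable (X u) P) :
    ∫ ω in Zs X d u, K ω * X u ω ∂P = 0 := by
  have hpos : ∀ (n : ℕ) (x : ℝ), 0 < 1 + 1 / ((n : ℝ) + 1) * |x| := fun n x => by positivity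
  refine first_zero_lim hX hdu K hK hKb (fun n x => x / (1 + 1 / ((n : ℝ) + 1) * |x|))
    (fun n => ?_) (fun n => (n : ℝ) + 1) (fun n x => ?_) (fun n x => ?_) (fun x => x) (fun x => |x|)
    (fun n x => ?_) hi.abs (fun x => ?_)
  · exact continuous_id.div₀ (by fun_prop) fun x => (hpos n x).ne'
  · rw [abs_div, abs_of_pos (hpos n x), div_le_iff₀ (hpos n x)]
    have : ((n : ℝ) + 1) * (1 + 1 / ((n : ℝ) + 1) * |x|) = (n : ℝ) + 1 + |x| := by
      field_simp
    rw [this]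
    linarith [(by positivity : (0 : ℝ) ≤ n)]
  · rw [abs_neg, neg_div]
  · rw [abs_div, abs_of_pos (hpos n x), div_le_iff₀ (hpos n x)]
    have h0 : (0 : ℝ) ≤ 1 / ((n : ℝ) + 1) * |x| := by positivity
    nlinarith [abs_nonneg x]
  · have h1 := (tendsto_one_div_add_atTop_nhds_zero_nat (𝕜 := ℝ)).mul_const |x|
    have h2 := (h1.const_add 1)
    have h3 := (tendsto_const_nhds (x := x)).div h2 (by simp)
    simp only [zero_mul, add_zero, div_one] at h3
    exact h3

lemma first_zero_sign (hX : BMLike P X) {d u : ℝ≥0} (hdu : d ≤ u) (K : Ω → ℝ)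
    (hK : Measurable[Fil X d] K) (hKb : ∀ ω, |K ω| ≤ 1) :
    ∫ ω in Zs X d u, K ω * Real.sign (X u ω) ∂P = 0 := by
  have hpos : ∀ (n : ℕ) (x : ℝ), 0 < |x| + 1 / ((n : ℝ) + 1) := fun n x => by positivity
  have hb : ∀ (n : ℕ) (x : ℝ), |x / (|x| + 1 / ((n : ℝ) + 1))| ≤ 1 := by
    intro n x
    rw [abs_div, abs_of_pos (hpos n x), div_le_iff₀ (hpos n x)]
    have h0 : (0 : ℝ) ≤ 1 / ((n : ℝ) + 1) := by positivity
    linarith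
  refine first_zero_lim hX hdu K hK hKb (fun n x => x / (|x| + 1 / ((n : ℝ) + 1)))
    (fun n => ?_) (fun n => 1) hb (fun n x => ?_) _ (fun x => 1)
    hb (integrable_const _) (fun x => ?_)
  · exact continuous_id.div₀ (by fun_prop) fun x => (hpos n x).ne'
  · rw [abs_neg, neg_div]
  · have h2 := (tendsto_one_div_add_atTop_nhds_zero_nat (𝕜 := ℝ)).const_add |x|
    rw [add_zero] at h2
    rcases lt_trichotomy x 0 with h | h | h
    · have h3 := (tendsto_const_nhds (x := x)).div h2 (by simp [h.ne])
      rw [abs_of_neg h, div_neg, div_self h.ne] at h3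
      rw [Real.sign_of_neg h, abs_of_neg h]
      exact h3
    · simp [h]
    · have h3 := (tendsto_const_nhds (x := x)).div h2 (by simp [h.ne'])
      rw [abs_of_pos h, div_self h.ne'] at h3
      rw [Real.sign_of_pos h, abs_of_pos h]
      exact h3

lemma sign_const (hc : ∀ ω, Continuous fun t => X t ω) {a b : ℝ≥0} {ω : Ω} (hω : ω ∉ Zs X a b)
    {s t : ℝ≥0} (hs : a ≤ s) (hst : s ≤ t) (ht : t ≤ b) :
    Real.sign (X s ω) = Real.sign (X t ω) := by
  have hne : ∀ r, a ≤ r → r ≤ b → X r ω ≠ 0 := fun r h1 h2 h3 => hω ⟨r, h1, h2, h3⟩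
  have hs' := hne s hs (hst.trans ht)
  have ht' := hne t (hs.trans hst) ht
  rcases lt_or_gt_of_ne hs' with h1 | h1 <;> rcases lt_or_gt_of_ne ht' with h2 | h2
  · rw [Real.sign_of_neg h1, Real.sign_of_neg h2]
  · obtain ⟨r, hr, h0⟩ := intermediate_value_Icc hst (hc ω).continuousOn ⟨h1.le, h2.le⟩
    exact absurd h0 (hne r (hs.trans hr.1) (hr.2.trans ht))
  · obtain ⟨r, hr, h0⟩ := intermediate_value_Icc' hst (hc ω).continuousOn ⟨h2.le, h1.le⟩
    exact absurd h0 (hne r (hs.trans hr.1) (hr.2.trans ht))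
  · rw [Real.sign_of_pos h1, Real.sign_of_pos h2]

lemma BMLike.add_const (hX : BMLike P X) (e : ℝ) : BMLike P (fun t ω => X t ω + e) where
  meas t := (hX.meas t).add_const e
  cont ω := (hX.cont ω).add_const e
  gauss s t h := by simpa using hX.gauss s t h
  indep s t h := by
    have := (hX.indep s t h).comp measurable_id
      (ψ := fun (p : {u : ℝ≥0 // u ≤ s} → ℝ) u => p u + e) (by fun_prop)
    simpa [Function.comp_def] using this

lemma BMLike.neg (hX : BMLike P X) : BMLike P (fun t ω => - X t ω) where
  meas t := (hX.meas t).neg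
  cont ω := (hX.cont ω).neg
  gauss s t h := by
    have h1 : (fun ω => - X t ω - - X s ω) = (fun x => -x) ∘ fun ω => X t ω - X s ω := by
      ext ω; simp; ring
    have hd : Measurable fun ω => X t ω - X s ω := (hX.meas t).sub (hX.meas s)
    rw [h1, ← Measure.map_map (g := fun x : ℝ => -x) measurable_neg hd, hX.gauss s t h,
      gaussianReal_map_neg, neg_zero]
  indep s t h := by
    have := (hX.indep s t h).comp (φ := fun x : ℝ => -x) measurable_neg
      (ψ := fun (p : {u : ℝ≥0 // u ≤ s} → ℝ) u => - p u) (by fun_prop)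
    convert this using 1
    · ext ω; simp; ring
    · rfl

lemma prob_pos (hX : BMLike P X) {r u : ℝ≥0} (hru : r ≤ u) :
    P.real ({ω | 0 < X r ω} \ Zs X r u)
      = ∫ ω, {ω | 0 < X r ω}.indicator (fun _ => (1 : ℝ)) ω * Real.sign (X u ω) ∂P := by
  have hZm : MeasurableSet (Zs X r u) := fil_le X hX.meas _ _ (zs_meas X hX.cont _ _)
  have hKm : Measurable[Fil X r] ({ω | 0 < X r ω}.indicator (fun _ => (1 : ℝ))) :=
    measurable_const.indicator (measurable_fil X le_rfl measurableSet_Ioi)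
  have hA : MeasurableSet {ω | 0 < X r ω} := hX.meas r measurableSet_Ioi
  have hKb : ∀ ω, |{ω | 0 < X r ω}.indicator (fun _ => (1 : ℝ)) ω| ≤ 1 := by
    intro ω
    by_cases h : ω ∈ {ω | 0 < X r ω} <;> simp only [h, indicator_of_mem, indicator_of_notMem,
      not_false_eq_true, abs_one, abs_zero, le_refl, zero_le_one]
  have h1 := first_zero_sign hX hru _ hKm hKb
  have hIntg : Integrable (fun ω => {ω | 0 < X r ω}.indicator (fun _ => (1 : ℝ)) ω
      * Real.sign (X u ω)) P := by
    refine Integrable.of_bound (((measurable_const.indicator hA).mul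
      (measurable_sign.comp (hX.meas u))).aestronglyMeasurable) 1 (Eventually.of_forall fun ω => ?_)
    rw [norm_mul]
    exact mul_le_one₀ (hKb ω) (norm_nonneg _) (abs_sign_le _)
  rw [← integral_add_compl hZm hIntg, h1, zero_add, ← integral_indicator hZm.compl,
    ← integral_indicator_one (hA.diff hZm)]
  congr 1
  ext ω
  by_cases hz : ω ∈ Zs X r u
  · simp [hz]
  by_cases hp : 0 < X r ω
  · have : Real.sign (X u ω) = 1 := by
      rw [← sign_const hX.cont hz le_rfl hru le_rfl, Real.sign_of_pos hp]
    simp [hz, hp, this]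
  · simp [hz, hp]

lemma touch (hX : BMLike P X) {r u : ℝ≥0} (hru : r ≤ u) (hr : ∀ᵐ ω ∂P, X r ω ≠ 0)
    (hu : ∀ᵐ ω ∂P, X u ω ≠ 0) :
    P {ω | (∀ s, r ≤ s → s ≤ u → 0 ≤ X s ω) ∧ ω ∈ Zs X r u} = 0 := by
  set C := {ω | (∀ s, r ≤ s → s ≤ u → 0 ≤ X s ω) ∧ ω ∈ Zs X r u} with hCdef
  set S : ℝ → Set Ω := fun e => {ω | 0 < X r ω + e} \ Zs (fun t ω => X t ω + e) r u with hS
  have hprob : ∀ e, P.real (S e) = ∫ ω, {ω | 0 < X r ω + e}.indicator (fun _ => (1 : ℝ)) ω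
      * Real.sign (X u ω + e) ∂P := fun e => prob_pos (hX.add_const e) hru
  have hZm : MeasurableSet (S 0) := by
    have h0 := hX.add_const 0
    exact (h0.meas r measurableSet_Ioi).diff (fil_le _ h0.meas _ _ (zs_meas _ h0.cont r u))
  have hlim : Tendsto (fun n : ℕ => P.real (S (1 / ((n : ℝ) + 1)))) atTop (𝓝 (P.real (S 0))) := by
    simp only [hprob]
    have he := tendsto_one_div_add_atTop_nhds_zero_nat (𝕜 := ℝ)
    refine tendsto_integral_of_dominated_convergence (fun _ => 1) ?_ (integrable_const _) ?_ ?_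
    · intro n
      have h0 := hX.add_const (1 / ((n : ℝ) + 1))
      exact (((measurable_const.indicator (h0.meas r measurableSet_Ioi)).mul
        (measurable_sign.comp (h0.meas u))).aestronglyMeasurable)
    · intro n
      refine Eventually.of_forall fun ω => ?_
      rw [norm_mul]
      refine mul_le_one₀ ?_ (norm_nonneg _) (abs_sign_le _)
      by_cases h : 0 < X r ω + 1 / ((n : ℝ) + 1) <;>
        simp [indicator, h, -one_div]
    · filter_upwards [hr, hu] with ω h1 h2
      have t1 := he.const_add (X r ω)
      have t2 := he.const_add (X u ω)
      rw [add_zero] at t1 t2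
      refine Tendsto.mul ?_ ?_
      · refine tendsto_nhds_of_eventually_eq ?_
        rcases lt_or_gt_of_ne h1 with h | h
        · filter_upwards [t1.eventually_lt_const h] with n hn
          simp [indicator, h.not_gt, hn.not_gt, -one_div]
        · filter_upwards [t1.eventually_const_lt h] with n hn
          simp [indicator, h, hn, -one_div]
      · refine tendsto_nhds_of_eventually_eq ?_
        rw [add_zero]
        rcases lt_or_gt_of_ne h2 with h | h
        · filter_upwards [t2.eventually_lt_const h] with n hn
          rw [Real.sign_of_neg h, Real.sign_of_neg hn]
        · filter_upwards [t2.eventually_const_lt h] with n hn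
          rw [Real.sign_of_pos h, Real.sign_of_pos hn]
  have hdisj : Disjoint C (S 0) := by
    rw [Set.disjoint_left]
    rintro ω ⟨-, hz⟩ ⟨-, hz2⟩
    simp only [add_zero] at hz2
    exact hz2 hz
  have hbound : ∀ n : ℕ, P.real C + P.real (S 0) ≤ P.real (S (1 / ((n : ℝ) + 1))) := by
    intro n
    have hpos : (0 : ℝ) < 1 / ((n : ℝ) + 1) := by positivity
    rw [← measureReal_union hdisj hZm]
    refine measureReal_mono ?_
    have key : ∀ ω, (∀ s, r ≤ s → s ≤ u → 0 ≤ X s ω) → ω ∈ S (1 / ((n : ℝ) + 1)) := by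
      intro ω h
      refine ⟨by have := h r le_rfl hru; simp only [mem_ofPred_eq]; linarith, ?_⟩
      rintro ⟨s, h1, h2, h3⟩
      have := h s h1 h2
      simp only at h3
      linarith
    rintro ω (⟨h, -⟩ | ⟨h1, h2⟩)
    · exact key ω h
    · simp only [add_zero, mem_ofPred_eq] at h1 h2
      refine key ω fun s hs1 hs2 => ?_
      have := sign_const hX.cont h2 le_rfl hs1 hs2
      rw [Real.sign_of_pos h1] at this
      by_contra hlt
      rw [Real.sign_of_neg (not_le.1 hlt)] at this
      norm_num at this
  have := le_of_tendsto_of_tendsto' tendsto_const_nhds hlim hbound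
  have h0 : P.real C = 0 := le_antisymm (by linarith) measureReal_nonneg
  exact (measureReal_eq_zero_iff).1 h0

/-- the Gaussian primitive -/
noncomputable def Phi (z : ℝ) : ℝ := ∫ t in (0 : ℝ)..z, Real.exp (-t ^ 2 / 2)

lemma Phi_cont : Continuous fun t : ℝ => Real.exp (-t ^ 2 / 2) := by fun_prop

lemma Phi_deriv (z : ℝ) : HasDerivAt Phi (Real.exp (-z ^ 2 / 2)) z :=
  intervalIntegral.integral_hasDerivAt_right (Phi_cont.intervalIntegrable _ _)
    (Phi_cont.stronglyMeasurableAtFilter _ _) Phi_cont.continuousAt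

lemma Phi_zero : Phi 0 = 0 := by simp [Phi]

lemma Phi_measurable : Measurable Phi :=
  (continuous_iff_continuousAt.2 fun z => (Phi_deriv z).continuousAt).measurable

lemma Phi_bound (z : ℝ) : |Phi z| ≤ |z| := by
  have := intervalIntegral.norm_integral_le_of_norm_le_const (a := 0) (b := z) (C := 1)
    (f := fun t : ℝ => Real.exp (-t ^ 2 / 2)) (fun t _ => by
      rw [Real.norm_eq_abs, abs_of_pos (Real.exp_pos _), Real.exp_le_one_iff]
      nlinarith [sq_nonneg t])
  simpa [Phi] using this

lemma gauss_std (z : ℝ) : ∫ y, Real.sign (z + y) ∂(gaussianReal 0 1)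
    = Real.sqrt (2 / Real.pi) * Phi z := by
  set γ := gaussianReal 0 1 with hγ
  have hna : NullSingletonClass γ := nullSingletonClass_gaussianReal one_ne_zero
  have hpdf : ∀ a : ℝ, γ.real (Iic a) = ∫ t in Iic a, gaussianPDFReal 0 1 t := by
    intro a
    rw [measureReal_def, hγ, gaussianReal_apply_eq_integral 0 one_ne_zero, ENNReal.toReal_ofReal]
    exact integral_nonneg fun t => gaussianPDFReal_nonneg _ _ _
  have hneg : γ.real (Iic 0) = γ.real (Ici 0) := by
    have h1 : γ = γ.map (fun y => - y) := by
      rw [hγ, gaussianReal_map_neg, neg_zero]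
    conv_lhs => rw [h1]
    rw [map_measureReal_apply measurable_neg measurableSet_Iic]
    congr 1
    ext y; simp
  have hhalf : γ.real (Iic 0) = 1 / 2 := by
    have h1 : γ.real (Ici 0) = γ.real (Ioi 0) := measureReal_congr Ioi_ae_eq_Ici.symm
    have h2 : γ.real (Ioi 0) = 1 - γ.real (Iic 0) := by
      rw [← compl_Iic, probReal_compl_eq_one_sub measurableSet_Iic]
    linarith
  have hsig : ∫ y, Real.sign (z + y) ∂γ = 1 - 2 * γ.real (Iic (-z)) := by
    have h1 : ∫ y, Real.sign (z + y) ∂γ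
        = ∫ y, (1 - 2 * (Iic (-z)).indicator (fun _ => (1 : ℝ)) y) ∂γ := by
      refine integral_congr_ae ?_
      have : ∀ᵐ y ∂γ, y ≠ -z := by
        rw [ae_iff]; simp
      filter_upwards [this] with y hy
      rcases lt_or_gt_of_ne hy with h | h
      · rw [Real.sign_of_neg (by linarith), indicator_of_mem (mem_Iic.2 h.le)]
        norm_num
      · rw [Real.sign_of_pos (by linarith), indicator_of_notMem (by simpa using h)]
        norm_num
    rw [h1, integral_sub (integrable_const _)
      (((integrable_const _).indicator measurableSet_Iic).const_mul _), integral_const_mul,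
      integral_indicator measurableSet_Iic]
    simp
  have hi := integrable_gaussianPDFReal 0 1
  have hdiff : γ.real (Iic 0) - γ.real (Iic (-z)) = (Real.sqrt (2 * Real.pi))⁻¹ * Phi z := by
    rw [hpdf, hpdf, intervalIntegral.integral_Iic_sub_Iic hi.integrableOn hi.integrableOn]
    have h1 := intervalIntegral.integral_comp_neg (a := 0) (b := z)
      (fun t => gaussianPDFReal 0 1 t)
    rw [neg_zero] at h1
    rw [← h1, Phi, ← intervalIntegral.integral_const_mul]
    congr 1
    ext t
    simp [gaussianPDFReal_def]
  have hc : 2 * (Real.sqrt (2 * Real.pi))⁻¹ = Real.sqrt (2 / Real.pi) := by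
    have hp := Real.pi_pos
    rw [Real.sqrt_div (by norm_num), Real.sqrt_mul (by norm_num)]
    have h2 : Real.sqrt 2 * Real.sqrt 2 = 2 := Real.mul_self_sqrt (by norm_num)
    have h3 : 0 < Real.sqrt Real.pi := Real.sqrt_pos.2 hp
    field_simp
    nlinarith
  rw [hsig, ← hc]
  linarith

lemma gauss_sign (x : ℝ) {w : ℝ≥0} (hw : w ≠ 0) : ∫ y, Real.sign (x + y) ∂(gaussianReal 0 w)
    = Real.sqrt (2 / Real.pi) * Phi (x / Real.sqrt w) := by
  have hs : 0 < Real.sqrt w := Real.sqrt_pos.2 (by positivity)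
  have h1 : gaussianReal 0 w = (gaussianReal 0 1).map (fun y => Real.sqrt w * y) := by
    rw [gaussianReal_map_const_mul]
    congr 1
    · simp
    · ext; simp
  rw [h1, integral_map (f := fun y => Real.sign (x + y)) (by fun_prop)
    (measurable_sign.comp (measurable_const_add x)).aestronglyMeasurable, ← gauss_std]
  congr 1
  ext y
  have : x + Real.sqrt w * y = Real.sqrt w * (x / Real.sqrt w + y) := by field_simp
  rw [this]
  rcases lt_trichotomy (x / Real.sqrt w + y) 0 with h | h | h
  · rw [Real.sign_of_neg h, Real.sign_of_neg (mul_neg_of_pos_of_neg hs h)]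
  · simp [h]
  · rw [Real.sign_of_pos h, Real.sign_of_pos (mul_pos hs h)]

end Azema

namespace Azema
open Filter Topology
set_option linter.unusedSectionVars false

variable {Ω : Type*} [m : MeasurableSpace Ω]
variable {P : Measure Ω} [IsProbabilityMeasure P] {B : ℝ≥0 → Ω → ℝ}

lemma map_eq (hB : BMLike P B) (h0 : ∀ ω, B 0 ω = 0) (t : ℝ≥0) :
    P.map (B t) = gaussianReal 0 t := by
  have := hB.gauss 0 t (zero_le)
  simpa [h0] using this

lemma integrable_bm (hB : BMLike P B) (h0 : ∀ ω, B 0 ω = 0) (t : ℝ≥0) : Integrable (B t) P := by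
  have h1 : Integrable id (P.map (B t)) := by
    rw [map_eq hB h0]
    exact (memLp_id_gaussianReal 1).integrable (by simp)
  exact (integrable_map_measure aestronglyMeasurable_id (hB.meas t).aemeasurable).1 h1

lemma ne_zero_bm (hB : BMLike P B) (h0 : ∀ ω, B 0 ω = 0) {t : ℝ≥0} (ht : 0 < t) :
    ∀ᵐ ω ∂P, B t ω ≠ 0 := by
  have h1 : ∀ᵐ x ∂(P.map (B t)), x ≠ 0 := by
    rw [map_eq hB h0]
    have := nullSingletonClass_gaussianReal (μ := 0) ht.ne'
    rw [ae_iff]; simp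
  exact ae_of_ae_map (hB.meas t).aemeasurable h1

/-- completed sign sigma-algebra -/
@[reducible]
noncomputable def SS (P : Measure Ω) (B : ℝ≥0 → Ω → ℝ) (u : ℝ≥0) : MeasurableSpace Ω :=
  (⨆ s : {s : ℝ≥0 // s ≤ u}, MeasurableSpace.comap (fun ω => Real.sign (B s ω)) ⊤)
          ⊔ MeasurableSpace.generateFrom {A : Set Ω | P A = 0}

lemma ss_mono {u v : ℝ≥0} (h : u ≤ v) : SS P B u ≤ SS P B v := by
  refine sup_le_sup_right (iSup_le fun s => ?_) _
  exact le_iSup (fun s : {s : ℝ≥0 // s ≤ v} =>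
    MeasurableSpace.comap (fun ω => Real.sign (B s ω)) ⊤) ⟨s, s.2.trans h⟩

lemma ss_null {u : ℝ≥0} {A : Set Ω} (h : P A = 0) : MeasurableSet[SS P B u] A :=
  (le_sup_right : _ ≤ SS P B u) _ (MeasurableSpace.measurableSet_generateFrom h)

lemma ss_sign {u s : ℝ≥0} (h : s ≤ u) : Measurable[SS P B u] (fun ω => Real.sign (B s ω)) := by
  have h1 : MeasurableSpace.comap (fun ω => Real.sign (B s ω)) ⊤ ≤ SS P B u :=
    (le_iSup (fun s : {s : ℝ≥0 // s ≤ u} =>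
      MeasurableSpace.comap (fun ω => Real.sign (B s ω)) ⊤) ⟨s, h⟩).trans le_sup_left
  intro A _
  exact h1 _ ⟨A, trivial, rfl⟩

/-- the sets that are locally determined before `d` off the zeros in `[d, u]` -/
@[reducible]
def Loc (P : Measure Ω) (B : ℝ≥0 → Ω → ℝ) (d u : ℝ≥0) : MeasurableSpace Ω where
  MeasurableSet' F := ∃ H, MeasurableSet[Fil B d] H ∧ ∀ᵐ ω ∂P, ω ∉ Zs B d u → (ω ∈ F ↔ ω ∈ H)
  measurableSet_empty := ⟨∅, @MeasurableSet.empty _ (Fil B d), by simp⟩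
  measurableSet_compl := by
    rintro F ⟨H, hH, h⟩
    refine ⟨Hᶜ, hH.compl, ?_⟩
    filter_upwards [h] with ω hω hz
    simp [hω hz]
  measurableSet_iUnion := by
    intro F h
    choose H hH h using h
    refine ⟨⋃ i, H i, MeasurableSet.iUnion hH, ?_⟩
    filter_upwards [ae_all_iff.2 h] with ω hω hz
    simp [fun i => hω i hz]

lemma ss_le_loc (hB : BMLike P B) {d u : ℝ≥0} (hdu : d ≤ u) : SS P B u ≤ Loc P B d u := by
  refine sup_le (iSup_le ?_) (MeasurableSpace.generateFrom_le ?_)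
  · rintro ⟨s, hs⟩ _ ⟨A, -, rfl⟩
    have key : ∀ A : Set ℝ, ∃ A' : Set ℝ, MeasurableSet A' ∧ ∀ x : ℝ,
        Real.sign x ∈ A ↔ Real.sign x ∈ A' := by
      intro A
      refine ⟨A ∩ {-1, 0, 1}, ((Set.toFinite _).subset inter_subset_right).measurableSet, ?_⟩
      intro x
      rcases Real.sign_apply_eq x with h | h | h <;> simp [h]
    obtain ⟨A', hA', hAA'⟩ := key A
    have hm : ∀ r, r ≤ d → MeasurableSet[Fil B d] ((fun ω => Real.sign (B r ω)) ⁻¹' A') :=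
      fun r hr => (measurable_sign.comp (measurable_fil B hr)) hA'
    rcases le_total s d with h | h
    · refine ⟨_, hm s h, Eventually.of_forall fun ω _ => ?_⟩
      exact hAA' _
    · refine ⟨_, hm d le_rfl, Eventually.of_forall fun ω hz => ?_⟩
      simp only [mem_preimage]
      rw [sign_const hB.cont hz le_rfl h hs]
      exact hAA' _
  · intro A hA
    refine ⟨∅, @MeasurableSet.empty _ (Fil B d), ?_⟩
    have : ∀ᵐ ω ∂P, ω ∉ A := by
      rw [ae_iff]; simpa using hA
    filter_upwards [this] with ω hω _
    simp [hω]

lemma mart (hB : BMLike P B) (h0 : ∀ ω, B 0 ω = 0) {s u : ℝ≥0} (hsu : s ≤ u) (K : Ω → ℝ)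
    (hK : Measurable[Fil B s] K) (hKb : ∀ ω, |K ω| ≤ 1) :
    ∫ ω, K ω * B u ω ∂P = ∫ ω, K ω * B s ω ∂P := by
  have e := markov hB hsu K hK hKb (fun z => z.1 + z.2) (by fun_prop)
    (by simpa using integrable_bm hB h0 u)
  have hh : ∀ x : ℝ, ∫ y, (x + y) ∂(gaussianReal 0 (u - s)) = x := by
    intro x
    have hi : Integrable (fun y : ℝ => y) (gaussianReal 0 (u - s)) :=
      (memLp_id_gaussianReal 1).integrable (by simp)
    rw [integral_add (integrable_const _) hi, integral_id_gaussianReal]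
    simp
  simpa [hh] using e

/-- ratio -/
noncomputable def rho (z : ℝ) : ℝ := Phi z / z

lemma rho_bound (z : ℝ) : |rho z| ≤ 1 := by
  rw [rho, abs_div]
  exact div_le_one_of_le₀ (Phi_bound z) (abs_nonneg z)

lemma rho_measurable : Measurable rho := Phi_measurable.div measurable_id

lemma rho_tendsto : Tendsto rho (𝓝[≠] 0) (𝓝 1) := by
  have h := (hasDerivAt_iff_tendsto_slope_zero).1 (Phi_deriv 0)
  simp only [zero_add, Phi_zero, sub_zero, smul_eq_mul] at h
  have h1 : Real.exp (-0 ^ 2 / 2) = 1 := by simp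
  rw [h1] at h
  refine h.congr fun t => ?_
  rw [rho, div_eq_inv_mul]

lemma const_mul_const : Real.sqrt (Real.pi / 2) * Real.sqrt (2 / Real.pi) = 1 := by
  have hp := Real.pi_pos
  rw [← Real.sqrt_mul (by positivity)]
  rw [show Real.pi / 2 * (2 / Real.pi) = 1 by field_simp]
  simp

lemma core_piece (hB : BMLike P B) (h0 : ∀ ω, B 0 ω = 0) {d u : ℝ≥0} (hdu : d ≤ u) (K : Ω → ℝ)
    (hK : Measurable[Fil B d] K) (hKb : ∀ ω, |K ω| ≤ 1) :
    ∫ ω in (Zs B d u)ᶜ, K ω * (Real.sqrt (Real.pi / 2) * Real.sqrt ((u - d : ℝ≥0) : ℝ)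
        * Real.sign (B u ω)) ∂P
      = ∫ ω in (Zs B d u)ᶜ, K ω * (B u ω * rho (B d ω / Real.sqrt ((u - d : ℝ≥0) : ℝ))) ∂P := by
  set w : ℝ≥0 := u - d with hw
  set c := Real.sqrt (Real.pi / 2) with hc
  by_cases hw0 : w = 0
  · simp [hw0, rho]
  have hs : 0 < Real.sqrt w := Real.sqrt_pos.2 (by positivity)
  have hle := fil_le B hB.meas d
  have hKm : Measurable K := hK.mono hle le_rfl
  have hZm : MeasurableSet (Zs B d u) := fil_le B hB.meas _ _ (zs_meas B hB.cont _ _)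
  have hBi := integrable_bm hB h0 u
  have hsi : Integrable (fun ω => Real.sign (B u ω)) P :=
    Integrable.of_bound (measurable_sign.comp (hB.meas u)).aestronglyMeasurable 1
      (Eventually.of_forall fun ω => abs_sign_le _)
  have hKsi : Integrable (fun ω => K ω * Real.sign (B u ω)) P :=
    hsi.bdd_mul hKm.aestronglyMeasurable (Eventually.of_forall hKb)
  set K' : Ω → ℝ := fun ω => K ω * rho (B d ω / Real.sqrt w) with hK'
  have hK'm : Measurable[Fil B d] K' :=
    hK.mul (rho_measurable.comp ((measurable_fil B le_rfl).div_const _))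
  have hK'b : ∀ ω, |K' ω| ≤ 1 := by
    intro ω
    rw [hK', abs_mul]
    exact mul_le_one₀ (hKb ω) (abs_nonneg _) (rho_bound _)
  have hK'i : Integrable (fun ω => K' ω * B u ω) P :=
    hBi.bdd_mul (hK'm.mono hle le_rfl).aestronglyMeasurable (Eventually.of_forall hK'b)
  have e1 := integral_add_compl hZm hKsi
  rw [first_zero_sign hB hdu K hK hKb, zero_add] at e1
  have e2 := integral_add_compl hZm hK'i
  rw [first_zero_id hB hdu K' hK'm hK'b hBi, zero_add, mart hB h0 hdu K' hK'm hK'b] at e2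
  have e3 := markov hB hdu K hK hKb (fun z => Real.sign (z.1 + z.2))
    (measurable_sign.comp (by fun_prop)) (by simpa using hsi)
  simp only [gauss_sign _ hw0, ← hw, add_sub_cancel] at e3
  have l1 : ∫ ω in (Zs B d u)ᶜ, K ω * (c * Real.sqrt w * Real.sign (B u ω)) ∂P
      = (c * Real.sqrt w) * ∫ ω in (Zs B d u)ᶜ, K ω * Real.sign (B u ω) ∂P := by
    rw [← integral_const_mul]
    congr 1
    ext ω; ring
  have l2 : ∫ ω in (Zs B d u)ᶜ, K ω * (B u ω * rho (B d ω / Real.sqrt w)) ∂P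
      = ∫ ω in (Zs B d u)ᶜ, K' ω * B u ω ∂P := by
    congr 1
    ext ω; simp only [hK']; ring
  rw [l1, l2, e1, e2, e3, ← integral_const_mul]
  congr 1
  ext ω
  simp only [hK', rho]
  have hcc := const_mul_const
  rw [← hc] at hcc
  by_cases hy : B d ω = 0
  · simp [hy, Phi_zero]
  · have : Phi (B d ω / Real.sqrt w) / (B d ω / Real.sqrt w) * B d ω
        = Real.sqrt w * Phi (B d ω / Real.sqrt w) := by
      field_simp
    rw [mul_assoc (K ω), this]
    linear_combination (K ω * Real.sqrt w * Phi (B d ω / Real.sqrt w)) * hcc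

lemma g_props (hB : BMLike P B) (h0 : ∀ ω, B 0 ω = 0) (u : ℝ≥0) (ω : Ω) (g : ℝ≥0)
    (hg : g = sSup {s : ℝ≥0 | s ≤ u ∧ B s ω = 0}) :
    g ≤ u ∧ B g ω = 0 ∧ ∀ s, s ≤ u → B s ω = 0 → s ≤ g := by
  have hbdd : BddAbove {s : ℝ≥0 | s ≤ u ∧ B s ω = 0} := ⟨u, fun s hs => hs.1⟩
  have hcl : IsClosed {s : ℝ≥0 | s ≤ u ∧ B s ω = 0} :=
    (isClosed_le continuous_id continuous_const).inter
        (isClosed_eq (hB.cont ω) continuous_const)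
  have hm := hcl.csSup_mem ⟨0, zero_le, h0 ω⟩ hbdd
  rw [← hg] at hm
  exact ⟨hm.1, hm.2, fun s h1 h2 => hg ▸ le_csSup hbdd ⟨h1, h2⟩⟩

lemma core (hB : BMLike P B) (h0 : ∀ ω, B 0 ω = 0) {u : ℝ≥0} (hu : 0 < u)
    (hle : SS P B u ≤ m) (F : Set Ω) (hF : MeasurableSet[SS P B u] F) (g : Ω → ℝ≥0)
    (hg : ∀ ω, g ω = sSup {s : ℝ≥0 | s ≤ u ∧ B s ω = 0}) :
    ∫ ω in F, Real.sign (B u ω) * Real.sqrt (Real.pi / 2)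
        * Real.sqrt ((u : ℝ) - (g ω : ℝ)) ∂P = ∫ ω in F, B u ω ∂P := by
  classical
  have hFm : MeasurableSet F := hle _ hF
  set c := Real.sqrt (Real.pi / 2) with hc
  have hc0 : 0 ≤ c := Real.sqrt_nonneg _
  have hgp := fun ω => g_props hB h0 u ω (g ω) (hg ω)
  have hne := ne_zero_bm hB h0 hu
  have hBi := integrable_bm hB h0 u
  have hBm := hB.meas
  set κ : ℕ → Ω → ℕ := fun n ω => ⌊((n : ℝ≥0) + 1) * g ω⌋₊ with hκ
  set dd : ℕ → ℕ → ℝ≥0 := fun n k => min u (((k : ℝ≥0) + 1) / ((n : ℝ≥0) + 1)) with hdd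
  have hddu : ∀ n k, dd n k ≤ u := fun n k => min_le_left _ _
  set Z1 : ℕ → ℕ → Set Ω := fun n k => Zs B ((k : ℝ≥0) / ((n : ℝ≥0) + 1)) (dd n k) with hZ1
  set E : ℕ → ℕ → Set Ω := fun n k => Z1 n k ∩ (Zs B (dd n k) u)ᶜ with hE
  have hglt : ∀ ω, B u ω ≠ 0 → g ω < u := by
    intro ω hω
    refine lt_of_le_of_ne (hgp ω).1 fun h => hω ?_
    rw [← h]; exact (hgp ω).2.1
  have hκiff : ∀ n k ω, κ n ω = k ↔ (k : ℝ≥0) / ((n : ℝ≥0) + 1) ≤ g ω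
      ∧ g ω < ((k : ℝ≥0) + 1) / ((n : ℝ≥0) + 1) := by
    intro n k ω
    simp only [hκ]
    rw [Nat.floor_eq_iff (by positivity), div_le_iff₀ (by positivity), lt_div_iff₀ (by positivity),
      mul_comm (g ω)]
  have hEiff : ∀ n k ω, B u ω ≠ 0 → (ω ∈ E n k ↔ κ n ω = k) := by
    intro n k ω hω
    rw [hκiff]
    constructor
    · rintro ⟨⟨s, h1, h2, h3⟩, hz⟩
      refine ⟨h1.trans ((hgp ω).2.2 s (h2.trans (hddu n k)) h3), ?_⟩
      by_contra hlt
      exact hz ⟨g ω, (min_le_right _ _).trans (not_lt.1 hlt), (hgp ω).1, (hgp ω).2.1⟩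
    · rintro ⟨h1, h2⟩
      have hlt : g ω < dd n k := lt_min (hglt ω hω) h2
      refine ⟨⟨g ω, h1, hlt.le, (hgp ω).2.1⟩, ?_⟩
      rintro ⟨s, h3, h4, h5⟩
      exact absurd ((hgp ω).2.2 s h4 h5) (not_le.2 (hlt.trans_le h3))
  have hZ2m : ∀ n k, MeasurableSet (Zs B (dd n k) u) := fun n k =>
    fil_le B hBm _ _ (zs_meas B hB.cont _ _)
  have hEm : ∀ n k, MeasurableSet (E n k) := fun n k =>
    (fil_le B hBm _ _ (zs_meas B hB.cont _ _)).inter (hZ2m n k).compl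
  set I : ℕ → ℕ → Ω → ℝ := fun n k => (F ∩ E n k).indicator (fun _ => (1 : ℝ)) with hI
  have hIm : ∀ n k, Measurable (I n k) := fun n k =>
    measurable_const.indicator (hFm.inter (hEm n k))
  have hIb : ∀ n k ω, |I n k ω| ≤ 1 := by
    intro n k ω
    by_cases h : ω ∈ F ∩ E n k
    · simp only [hI, indicator_of_mem h]; simp
    · simp only [hI, indicator_of_notMem h]; simp
  set L : ℕ → ℕ → Ω → ℝ := fun n k ω =>
    c * Real.sqrt ((u - dd n k : ℝ≥0) : ℝ) * Real.sign (B u ω) with hL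
  set R : ℕ → ℕ → Ω → ℝ := fun n k ω =>
    B u ω * rho (B (dd n k) ω / Real.sqrt ((u - dd n k : ℝ≥0) : ℝ)) with hR
  have hLm : ∀ n k, Measurable (L n k) := fun n k =>
    (measurable_sign.comp (hBm u)).const_mul _
  have hRm : ∀ n k, Measurable (R n k) := fun n k =>
    (hBm u).mul (rho_measurable.comp ((hBm _).div_const _))
  have hLb : ∀ n k ω, ‖L n k ω‖ ≤ c * Real.sqrt u := by
    intro n k ω
    simp only [hL, norm_mul, Real.norm_eq_abs, abs_of_nonneg hc0, abs_of_nonneg (Real.sqrt_nonneg _)]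
    have h1 : Real.sqrt ((u - dd n k : ℝ≥0) : ℝ) ≤ Real.sqrt u :=
      Real.sqrt_le_sqrt (by exact_mod_cast tsub_le_self)
    calc _ ≤ c * Real.sqrt u * 1 := by
          gcongr
          exact abs_sign_le _
      _ = _ := mul_one _
  have hRb : ∀ n k ω, ‖R n k ω‖ ≤ |B u ω| := by
    intro n k ω
    simp only [hR, norm_mul, Real.norm_eq_abs]
    exact mul_le_of_le_one_right (abs_nonneg _) (rho_bound _)
  have hLi : ∀ n k, Integrable (fun ω => I n k ω * L n k ω) P := fun n k =>
    (Integrable.of_bound (hLm n k).aestronglyMeasurable _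
      (Eventually.of_forall (hLb n k))).bdd_mul (hIm n k).aestronglyMeasurable
      (Eventually.of_forall (hIb n k))
  have hRi : ∀ n k, Integrable (fun ω => I n k ω * R n k ω) P := fun n k =>
    (hBi.abs.mono' (hRm n k).aestronglyMeasurable
      (Eventually.of_forall (hRb n k))).bdd_mul (hIm n k).aestronglyMeasurable
      (Eventually.of_forall (hIb n k))
  have hpiece : ∀ n k, ∫ ω, I n k ω * L n k ω ∂P = ∫ ω, I n k ω * R n k ω ∂P := by
    intro n k
    obtain ⟨H, hH, hFH⟩ := ss_le_loc hB (hddu n k) F hF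
    have hH'm : MeasurableSet[Fil B (dd n k)] (H ∩ Z1 n k) :=
      hH.inter (zs_meas B hB.cont _ _)
    have hcp := core_piece hB h0 (hddu n k) ((H ∩ Z1 n k).indicator fun _ => (1 : ℝ))
      (measurable_const.indicator hH'm) (fun ω => by
        by_cases h : ω ∈ H ∩ Z1 n k
        · simp only [indicator_of_mem h]; simp
        · simp only [indicator_of_notMem h]; simp)
    rw [← integral_indicator (hZ2m n k).compl, ← integral_indicator (hZ2m n k).compl] at hcp
    have hconv : ∀ Q : Ω → ℝ, ∫ ω, I n k ω * Q ω ∂P = ∫ ω, (Zs B (dd n k) u)ᶜ.indicator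
        (fun ω => (H ∩ Z1 n k).indicator (fun _ => (1 : ℝ)) ω * Q ω) ω ∂P := by
      intro Q
      refine integral_congr_ae ?_
      filter_upwards [hFH] with ω hω
      by_cases hz : ω ∈ Zs B (dd n k) u
      · simp [hI, hE, hz]
      · by_cases h1 : ω ∈ Z1 n k <;> by_cases h2 : ω ∈ F <;>
          have h3 := hω hz <;> simp only [h2, true_iff, false_iff] at h3 <;>
          simp [hI, hE, hz, h1, h2, h3]
    rw [hconv, hconv]
    exact hcp
  set N : ℕ → ℕ := fun n => ⌊((n : ℝ≥0) + 1) * u⌋₊ + 1 with hN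
  have hκN : ∀ n ω, κ n ω ∈ Finset.range (N n) := by
    intro n ω
    simp only [hκ, hN, Finset.mem_range]
    refine Nat.lt_succ_of_le (Nat.floor_mono ?_)
    have := (hgp ω).1
    gcongr
  have hsum : ∀ (n : ℕ) (Q : ℕ → Ω → ℝ) (ω : Ω), B u ω ≠ 0 →
      ∑ k ∈ Finset.range (N n), I n k ω * Q k ω
        = F.indicator (fun ω => Q (κ n ω) ω) ω := by
    intro n Q ω hω
    rw [Finset.sum_eq_single_of_mem (κ n ω) (hκN n ω)]
    · have : ω ∈ E n (κ n ω) := (hEiff _ _ _ hω).2 rfl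
      by_cases h : ω ∈ F <;> simp [hI, this, h]
    · intro k _ hk
      have : ω ∉ E n k := fun h => hk ((hEiff _ _ _ hω).1 h).symm
      simp [hI, this]
  have hddlim : ∀ ω, Tendsto (fun n => dd n (κ n ω)) atTop (𝓝 (g ω)) := by
    intro ω
    have h2 : Tendsto (fun n : ℕ => ((κ n ω : ℝ≥0) + 1) / ((n : ℝ≥0) + 1)) atTop (𝓝 (g ω)) := by
      refine tendsto_grid (fun n => ?_) (fun n => ?_)
      · exact ((hκiff n _ ω).1 rfl).2.le
      · rw [add_div]
        gcongr
        exact ((hκiff n _ ω).1 rfl).1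
    have := (tendsto_const_nhds (x := u)).min h2
    rwa [min_eq_right (hgp ω).1] at this
  have hwlim : ∀ ω, Tendsto (fun n => Real.sqrt ((u - dd n (κ n ω) : ℝ≥0) : ℝ)) atTop
      (𝓝 (Real.sqrt ((u : ℝ) - (g ω : ℝ)))) := by
    intro ω
    have h1 := (NNReal.tendsto_coe.2 (hddlim ω)).const_sub (u : ℝ)
    have h2 := (Real.continuous_sqrt.tendsto _).comp h1
    refine h2.congr fun n => ?_
    simp only [Function.comp]
    rw [NNReal.coe_sub (hddu _ _)]
  have hlimL : Tendsto (fun n : ℕ => ∫ ω, ∑ k ∈ Finset.range (N n), I n k ω * L n k ω ∂P) atTop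
      (𝓝 (∫ ω, F.indicator (fun ω => Real.sign (B u ω) * c
        * Real.sqrt ((u : ℝ) - (g ω : ℝ))) ω ∂P)) := by
    refine tendsto_integral_of_dominated_convergence (fun _ => c * Real.sqrt u) ?_
      (integrable_const _) ?_ ?_
    · intro n
      exact (Finset.measurable_fun_sum _ fun k _ => (hIm n k).mul (hLm n k)).aestronglyMeasurable
    · intro n
      filter_upwards [hne] with ω hω
      rw [hsum n (fun k => L n k) ω hω]
      exact (norm_indicator_le_norm_self _ _).trans (hLb _ _ _)
    · filter_upwards [hne] with ω hω
      simp only [fun n => hsum n (fun k => L n k) ω hω]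
      by_cases h : ω ∈ F
      · simp only [indicator_of_mem h, hL]
        have := ((hwlim ω).const_mul c).mul_const (Real.sign (B u ω))
        convert this using 2
        ring
      · simp only [indicator_of_notMem h]
        exact tendsto_const_nhds
  have hlimR : Tendsto (fun n : ℕ => ∫ ω, ∑ k ∈ Finset.range (N n), I n k ω * R n k ω ∂P) atTop
      (𝓝 (∫ ω, F.indicator (fun ω => B u ω) ω ∂P)) := by
    refine tendsto_integral_of_dominated_convergence (fun ω => |B u ω|) ?_
      hBi.abs ?_ ?_
    · intro n
      exact (Finset.measurable_fun_sum _ fun k _ => (hIm n k).mul (hRm n k)).aestronglyMeasurable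
    · intro n
      filter_upwards [hne] with ω hω
      rw [hsum n (fun k => R n k) ω hω]
      exact (norm_indicator_le_norm_self _ _).trans (hRb _ _ _)
    · filter_upwards [hne] with ω hω
      simp only [fun n => hsum n (fun k => R n k) ω hω]
      by_cases h : ω ∈ F
      · simp only [indicator_of_mem h, hR]
        have hpos : 0 < Real.sqrt ((u : ℝ) - (g ω : ℝ)) := by
          refine Real.sqrt_pos.2 (sub_pos.2 ?_)
          exact_mod_cast hglt ω hω
        have h1 : Tendsto (fun n => B (dd n (κ n ω)) ω) atTop (𝓝 0) := by
          have := ((hB.cont ω).tendsto (g ω)).comp (hddlim ω)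
          rwa [(hgp ω).2.1] at this
        have h2 : Tendsto (fun n => B (dd n (κ n ω)) ω
            / Real.sqrt ((u - dd n (κ n ω) : ℝ≥0) : ℝ)) atTop (𝓝 0) := by
          have := h1.div (hwlim ω) hpos.ne'
          rwa [zero_div] at this
        have h3 : ∀ᶠ n in atTop, B (dd n (κ n ω)) ω
            / Real.sqrt ((u - dd n (κ n ω) : ℝ≥0) : ℝ) ∈ ({0}ᶜ : Set ℝ) := by
          filter_upwards [(hwlim ω).eventually_const_lt hpos] with n hn
          have hmem : ω ∈ E n (κ n ω) := (hEiff _ _ _ hω).2 rfl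
          have : B (dd n (κ n ω)) ω ≠ 0 := fun h => hmem.2 ⟨_, le_rfl, hddu _ _, h⟩
          exact div_ne_zero this hn.ne'
        have h4 := rho_tendsto.comp (tendsto_nhdsWithin_iff.2 ⟨h2, h3⟩)
        have := h4.const_mul (B u ω)
        rwa [mul_one] at this
      · simp only [indicator_of_notMem h]
        exact tendsto_const_nhds
  have heq : ∀ n, ∫ ω, ∑ k ∈ Finset.range (N n), I n k ω * L n k ω ∂P
      = ∫ ω, ∑ k ∈ Finset.range (N n), I n k ω * R n k ω ∂P := by
    intro n
    rw [integral_finsetSum _ fun k _ => hLi n k, integral_finsetSum _ fun k _ => hRi n k]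
    exact Finset.sum_congr rfl fun k _ => hpiece n k
  have := tendsto_nhds_unique hlimL (hlimR.congr fun n => (heq n).symm)
  rwa [integral_indicator hFm, integral_indicator hFm] at this

lemma mart_ss (hB : BMLike P B) (h0 : ∀ ω, B 0 ω = 0) {v t : ℝ≥0} (hv : 0 < v) (hvt : v ≤ t)
    (hle : SS P B v ≤ m) (F : Set Ω) (hF : MeasurableSet[SS P B v] F) :
    ∫ ω in F, B t ω ∂P = ∫ ω in F, B v ω ∂P := by
  obtain ⟨H, hH, hFH⟩ := ss_le_loc hB (le_refl v) F hF
  have hHm : MeasurableSet H := fil_le B hB.meas _ _ hH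
  have hae : F =ᵐ[P] H := by
    rw [eventuallyEq_set]
    filter_upwards [hFH, ne_zero_bm hB h0 hv] with ω h1 h2
    refine h1 ?_
    rintro ⟨s, h3, h4, h5⟩
    rw [le_antisymm h4 h3] at h5
    exact h2 h5
  rw [setIntegral_congr_set hae, setIntegral_congr_set hae]
  have := mart hB h0 hvt (H.indicator fun _ => (1 : ℝ)) (measurable_const.indicator hH)
    (fun ω => by by_cases h : ω ∈ H <;> simp [h])
  rw [← integral_indicator hHm, ← integral_indicator hHm]
  convert this using 3 with ω ω
  · by_cases h : ω ∈ H <;> simp [h]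
  · by_cases h : ω ∈ H <;> simp [h]

lemma nz_meas (hB : BMLike P B) (h0 : ∀ ω, B 0 ω = 0) {r u : ℝ≥0} (hr : 0 < r) (hru : r ≤ u) :
    MeasurableSet[SS P B u] (Zs B r u)ᶜ := by
  have : Nonempty (Icc r u) := ⟨⟨r, le_refl _, hru⟩⟩
  set q := TopologicalSpace.denseSeq (Icc r u) with hq
  set Dp : ℝ → Set Ω := fun e => ⋂ i, {ω | Real.sign (B (q i) ω) = e} with hDp
  have hDm : ∀ e, MeasurableSet[SS P B u] (Dp e) := fun e =>
    MeasurableSet.iInter fun i => (ss_sign (q i).2.2) (measurableSet_singleton e)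
  have hclosed : ∀ (X : ℝ≥0 → Ω → ℝ), (∀ ω, Continuous fun t => X t ω) → ∀ ω,
      (∀ i, 0 ≤ X (q i) ω) → ∀ s, r ≤ s → s ≤ u → 0 ≤ X s ω := by
    intro X hX ω h s h1 h2
    have hcl : IsClosed {t : Icc r u | 0 ≤ X t ω} :=
      isClosed_le continuous_const ((hX ω).comp continuous_subtype_val)
    have hsub : closure (range q) ⊆ {t : Icc r u | 0 ≤ X t ω} :=
      closure_minimal (by rintro _ ⟨i, rfl⟩; exact h i) hcl
    have hd := (TopologicalSpace.denseRange_denseSeq (Icc r u)).closure_range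
    rw [hd] at hsub
    exact hsub (mem_univ (⟨s, h1, h2⟩ : Icc r u))
  have hu := hr.trans_le hru
  have t1 := touch hB hru (ne_zero_bm hB h0 hr) (ne_zero_bm hB h0 hu)
  have t2 := touch hB.neg hru (by simpa using ne_zero_bm hB h0 hr)
    (by simpa using ne_zero_bm hB h0 hu)
  have n1 : P (Dp 1 ∩ Zs B r u) = 0 := by
    refine measure_mono_null ?_ t1
    rintro ω ⟨h1, h2⟩
    refine ⟨hclosed B hB.cont ω fun i => ?_, h2⟩
    have := mem_iInter.1 h1 i
    simp only [mem_ofPred_eq] at this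
    by_contra hlt
    rw [Real.sign_of_neg (not_le.1 hlt)] at this
    norm_num at this
  have n2 : P (Dp (-1) ∩ Zs B r u) = 0 := by
    refine measure_mono_null ?_ t2
    rintro ω ⟨h1, h2⟩
    refine ⟨hclosed (fun t ω => - B t ω) hB.neg.cont ω fun i => ?_, ?_⟩
    · have := mem_iInter.1 h1 i
      simp only [mem_ofPred_eq] at this
      by_contra hlt
      rw [Real.sign_of_pos (by linarith)] at this
      norm_num at this
    · obtain ⟨s, a, b, e⟩ := h2
      exact ⟨s, a, b, by simp [e]⟩
  have hrep : (Zs B r u)ᶜ = (Dp 1 \ (Dp 1 ∩ Zs B r u)) ∪ (Dp (-1) \ (Dp (-1) ∩ Zs B r u)) := by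
    ext ω
    constructor
    · intro hz
      have hc : ∀ i, Real.sign (B (q i) ω) = Real.sign (B r ω) := fun i =>
        (sign_const hB.cont hz le_rfl (q i).2.1 (q i).2.2).symm
      have hne : B r ω ≠ 0 := fun h => hz ⟨r, le_rfl, hru, h⟩
      rcases lt_or_gt_of_ne hne with h | h
      · right
        refine ⟨mem_iInter.2 fun i => ?_, fun h => hz h.2⟩
        simp only [mem_ofPred_eq]
        rw [hc, Real.sign_of_neg h]
      · left
        refine ⟨mem_iInter.2 fun i => ?_, fun h => hz h.2⟩
        simp only [mem_ofPred_eq]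
        rw [hc, Real.sign_of_pos h]
    · rintro (⟨h1, h2⟩ | ⟨h1, h2⟩)
      · exact fun h => h2 ⟨h1, h⟩
      · exact fun h => h2 ⟨h1, h⟩
  rw [hrep]
  exact ((hDm 1).diff (ss_null n1)).union ((hDm (-1)).diff (ss_null n2))

lemma g_meas (hB : BMLike P B) (h0 : ∀ ω, B 0 ω = 0) {u : ℝ≥0} (g : Ω → ℝ≥0)
    (hg : ∀ ω, g ω = sSup {s : ℝ≥0 | s ≤ u ∧ B s ω = 0}) : Measurable[SS P B u] g := by
  have hgp := fun ω => g_props hB h0 u ω (g ω) (hg ω)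
  refine measurable_of_Iio fun r => ?_
  rcases (zero_le (a := r)).eq_or_lt with hr | hr
  · have : g ⁻¹' Iio r = ∅ := by
      ext ω; simp [← hr]
    rw [this]; exact @MeasurableSet.empty _ (SS P B u)
  by_cases hru : r ≤ u
  · have : g ⁻¹' Iio r = (Zs B r u)ᶜ := by
      ext ω
      simp only [mem_preimage, mem_Iio, mem_compl_iff]
      constructor
      · rintro h ⟨s, h1, h2, h3⟩
        exact absurd ((hgp ω).2.2 s h2 h3) (not_le.2 (h.trans_le h1))
      · intro hz
        by_contra hlt
        exact hz ⟨g ω, not_lt.1 hlt, (hgp ω).1, (hgp ω).2.1⟩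
    rw [this]
    exact nz_meas hB h0 hr hru
  · have : g ⁻¹' Iio r = univ := by
      ext ω
      simp only [mem_preimage, mem_Iio, mem_univ, iff_true]
      exact (hgp ω).1.trans_lt (not_le.1 hru)
    rw [this]; exact @MeasurableSet.univ _ (SS P B u)

end Azema

namespace Azema
open Filter Topology
set_option linter.unusedSectionVars false

theorem main
    {Ω : Type*} [m : MeasurableSpace Ω] (P : Measure Ω) [IsProbabilityMeasure P]
    (B : ℝ≥0 → Ω → ℝ) (hB : BMLike P B)
    (h0 : ∀ ω, B 0 ω = 0)
    (𝒜 : Filtration ℝ≥0 m)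
    (h𝒜 : ∀ t : ℝ≥0, (𝒜 t : MeasurableSpace Ω) = ⨅ u : {u : ℝ≥0 // t < u}, SS P B u)
    (g : ℝ≥0 → Ω → ℝ≥0)
    (hg : ∀ t ω, g t ω = sSup {s : ℝ≥0 | s ≤ t ∧ B s ω = 0})
    (A : ℝ≥0 → Ω → ℝ)
    (hA : ∀ t ω, A t ω = Real.sign (B t ω) * Real.sqrt (Real.pi / 2)
        * Real.sqrt ((t : ℝ) - (g t ω : ℝ))) :
    Martingale A 𝒜 P := by
  have hSA : ∀ u, SS P B u ≤ 𝒜 u := by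
    intro u
    rw [h𝒜]
    exact le_iInf fun v => ss_mono v.2.le
  have hS : ∀ u, SS P B u ≤ m := fun u => (hSA u).trans (𝒜.le u)
  have hAS : ∀ s v, s < v → (𝒜 s : MeasurableSpace Ω) ≤ SS P B v := by
    intro s v h
    rw [h𝒜]
    exact iInf_le (fun u : {u : ℝ≥0 // s < u} => SS P B u) ⟨v, h⟩
  have hAe : ∀ t, A t = fun ω => Real.sign (B t ω) * Real.sqrt (Real.pi / 2)
        * Real.sqrt ((t : ℝ) - (g t ω : ℝ)) := fun t => funext (hA t)
  have hAm : ∀ t, Measurable[SS P B t] (A t) := by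
    intro t
    rw [hAe]
    have h1 := ss_sign (P := P) (B := B) (le_refl t)
    have h2 := g_meas hB h0 (u := t) (g t) (hg t)
    exact (h1.mul_const _).mul
      (Real.continuous_sqrt.measurable.comp (measurable_const.sub (measurable_coe_nnreal_real.comp h2)))
  have hadp : ∀ t, StronglyMeasurable[𝒜 t] (A t) := fun t =>
    ((hAm t).mono (hSA t) le_rfl).stronglyMeasurable
  have hbd : ∀ t ω, |A t ω| ≤ Real.sqrt (Real.pi / 2) * Real.sqrt t := by
    intro t ω
    rw [hA, abs_mul, abs_mul, abs_of_nonneg (Real.sqrt_nonneg _), abs_of_nonneg (Real.sqrt_nonneg _)]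
    have h1 := abs_sign_le (B t ω)
    have h2 : Real.sqrt ((t : ℝ) - (g t ω : ℝ)) ≤ Real.sqrt t :=
      Real.sqrt_le_sqrt (by have := (g t ω).2; simp)
    calc _ ≤ 1 * Real.sqrt (Real.pi / 2) * Real.sqrt t := by gcongr
      _ = _ := by ring
  have hIntg : ∀ t, Integrable (A t) P := fun t =>
    Integrable.of_bound (((hadp t).mono (𝒜.le t)).aestronglyMeasurable) _
      (Eventually.of_forall fun ω => by simpa using hbd t ω)
  refine ⟨hadp, fun s t hst => ?_⟩
  refine (ae_eq_condExp_of_forall_setIntegral_eq (𝒜.le s) (hIntg t)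
    (fun F _ _ => (hIntg s).integrableOn) (fun F hF _ => ?_) (hadp s).aestronglyMeasurable).symm
  rcases hst.eq_or_lt with rfl | hlt
  · rfl
  set v : ℕ → ℝ≥0 := fun n => s + (t - s) / ((n : ℝ≥0) + 1) with hv
  have hts : 0 < t - s := tsub_pos_of_lt hlt
  have hsv : ∀ n, s < v n := fun n => by
    have : 0 < (t - s) / ((n : ℝ≥0) + 1) := by positivity
    exact lt_add_of_pos_right _ this
  have hvt : ∀ n, v n ≤ t := fun n => by
    have : (t - s) / ((n : ℝ≥0) + 1) ≤ t - s := div_le_self zero_le (by simp)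
    calc v n ≤ s + (t - s) := by simp only [hv]; gcongr
      _ = t := add_tsub_cancel_of_le hst
  have hvs : Tendsto v atTop (𝓝 s) := by
    have h1 : Tendsto (fun n : ℕ => (t - s) / ((n : ℝ≥0) + 1)) atTop (𝓝 0) := by
      rw [← NNReal.tendsto_coe]
      push_cast
      exact (tendsto_const_div_atTop_nhds_zero_nat ((t - s : ℝ≥0) : ℝ)).comp (tendsto_add_atTop_nat 1) |>.congr
        (fun n => by simp)
    simpa using h1.const_add s
  have heq : ∀ n, ∫ ω in F, A (v n) ω ∂P = ∫ ω in F, A t ω ∂P := by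
    intro n
    have hFv := hAS s (v n) (hsv n) F hF
    have hv0 : 0 < v n := zero_le.trans_lt (hsv n)
    rw [hAe, hAe, core hB h0 hv0 (hS _) F hFv (g (v n)) (hg _),
      core hB h0 (hv0.trans_le (hvt n)) (hS _) F (ss_mono (hvt n) F hFv) (g t) (hg _),
      mart_ss hB h0 hv0 (hvt n) (hS _) F hFv]
  have hlim : ∀ᵐ ω ∂P, Tendsto (fun n => A (v n) ω) atTop (𝓝 (A s ω)) := by
    rcases (zero_le (a := s)).eq_or_lt with hs0 | hs0
    · refine Eventually.of_forall fun ω => ?_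
      have hz : A s ω = 0 := by rw [hA, ← hs0, h0]; simp
      rw [hz]
      refine squeeze_zero_norm (fun n => hbd (v n) ω) ?_
      have : Tendsto (fun n => Real.sqrt (v n : ℝ)) atTop (𝓝 (Real.sqrt (s : ℝ))) :=
        (Real.continuous_sqrt.tendsto _).comp ((NNReal.tendsto_coe).2 hvs)
      simpa [← hs0] using this.const_mul (Real.sqrt (Real.pi / 2))
    · filter_upwards [ne_zero_bm hB h0 hs0] with ω hω
      have hev : ∀ᶠ r in 𝓝 s, B r ω ≠ 0 := (hB.cont ω).continuousAt.eventually_ne hω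
      obtain ⟨ε, hε, hb⟩ := Metric.eventually_nhds_iff.1 hev
      have h2 : ∀ᶠ n in atTop, dist (v n) s < ε := (Metric.tendsto_nhds.1 hvs) ε hε
      have hsq : Tendsto (fun n => Real.sign (B s ω) * Real.sqrt (Real.pi / 2)
          * Real.sqrt ((v n : ℝ) - (g s ω : ℝ))) atTop (𝓝 (A s ω)) := by
        rw [hA]
        exact ((Real.continuous_sqrt.tendsto _).comp
          (((NNReal.tendsto_coe).2 hvs).sub_const _)).const_mul _
      refine hsq.congr' ?_
      filter_upwards [h2] with n hn
      have hnz : ∀ r, s ≤ r → r ≤ v n → B r ω ≠ 0 := by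
        intro r h3 h4
        apply hb
        refine lt_of_le_of_lt ?_ hn
        rw [NNReal.dist_eq, NNReal.dist_eq]
        have h3' : (s : ℝ) ≤ r := h3
        have h4' : (r : ℝ) ≤ v n := h4
        rw [abs_of_nonneg (by linarith), abs_of_nonneg (by linarith)]
        linarith
      have hsg : Real.sign (B s ω) = Real.sign (B (v n) ω) :=
        sign_const hB.cont (a := s) (b := v n)
          (fun ⟨r, h5, h6, h7⟩ => hnz r h5 h6 h7) le_rfl (hsv n).le le_rfl
      obtain ⟨a1, a2, a3⟩ := g_props hB h0 s ω (g s ω) (hg s ω)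
      obtain ⟨b1, b2, b3⟩ := g_props hB h0 (v n) ω (g (v n) ω) (hg (v n) ω)
      have hgs : g (v n) ω ≤ s := by
        by_contra hc
        exact hnz _ (not_le.1 hc).le b1 b2
      have hge : g s ω = g (v n) ω :=
        le_antisymm (b3 _ (a1.trans (hsv n).le) a2) (a3 _ hgs b2)
      rw [hA, hsg, hge]
  have hD : Tendsto (fun n => ∫ ω in F, A (v n) ω ∂P) atTop (𝓝 (∫ ω in F, A s ω ∂P)) := by
    refine tendsto_integral_of_dominated_convergence (fun _ => Real.sqrt (Real.pi / 2) * Real.sqrt t)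
      (fun n => (hIntg _).integrableOn.aestronglyMeasurable) (integrable_const _)
      (fun n => Eventually.of_forall fun ω => ?_) (ae_restrict_of_ae hlim)
    refine (hbd (v n) ω).trans ?_
    have : (v n : ℝ) ≤ t := hvt n
    gcongr
  simp_rw [heq] at hD
  exact tendsto_nhds_unique hD tendsto_const_nhds

end Azema

/-- Azéma's martingale: if `B` is a standard Brownian motion,
`g_t = sup {s ≤ t : B_s = 0}` is the last zero before `t`, and `𝒜` is the completed,
right-continuous filtration generated by `(sign B_s)_{s ≤ t}`, then
`A_t = sign (B_t) √(π/2) √(t - g_t)` is an `𝒜`-martingale. -/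
theorem azema_martingale
    {Ω : Type*} [m : MeasurableSpace Ω] (P : Measure Ω) [IsProbabilityMeasure P]
    (B : ℝ≥0 → Ω → ℝ)
    (hmeas : ∀ t, Measurable (B t))
    (hcont : ∀ ω, Continuous fun t => B t ω)
    (h0 : ∀ ω, B 0 ω = 0)
    (hgauss : ∀ s t : ℝ≥0, s ≤ t →
      P.map (fun ω => B t ω - B s ω) = gaussianReal 0 (t - s))
    (hindep : ∀ s t : ℝ≥0, s ≤ t →
      IndepFun (fun ω => B t ω - B s ω)
        (fun ω => fun u : {u : ℝ≥0 // u ≤ s} => B u ω) P)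
    (𝒜 : Filtration ℝ≥0 m)
    (h𝒜 : ∀ t : ℝ≥0, (𝒜 t : MeasurableSpace Ω) = ⨅ u : {u : ℝ≥0 // t < u},
        ((⨆ s : {s : ℝ≥0 // s ≤ (u : ℝ≥0)},
            MeasurableSpace.comap (fun ω => Real.sign (B s ω)) ⊤)
          ⊔ MeasurableSpace.generateFrom {A : Set Ω | P A = 0}))
    (g : ℝ≥0 → Ω → ℝ≥0)
    (hg : ∀ t ω, g t ω = sSup {s : ℝ≥0 | s ≤ t ∧ B s ω = 0})
    (A : ℝ≥0 → Ω → ℝ)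
    (hA : ∀ t ω, A t ω = Real.sign (B t ω) * Real.sqrt (Real.pi / 2)
        * Real.sqrt ((t : ℝ) - (g t ω : ℝ))) :
    Martingale A 𝒜 P := by
  exact Azema.main P B ⟨hmeas, hcont, hgauss, hindep⟩ h0 𝒜 h𝒜 g hg A hA
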